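/- Let f : ℝ → ℝ and, for each i ∈ ℕ, f_i : ℝ → ℝ be 1-periodic, bounded, nonnegative functions whose sets of discontinuity points have Lebesgue measure zero, and suppose f_i → f uniformly on ℝ. Let α > 0, let (α_i)_{i∈ℕ} be a sequence of positive reals with α_i ≠ α for all i and lim_{i→∞} α_i = α, and let (y_i)_{i∈ℕ} be any sequence of reals. For each i define Ξ_i : ℤ → ℝ by: Ξ_i(z) = (1/q_i)·Σ_{k=0}^{q_i−1} f_i(y_i + kα_i)·f_i(y_i + (k−z)α_i) if α_i = p_i/q_i is rational with p_i, q_i positive coprime integers, and Ξ_i(z) = ∫₀¹ f_i(x)·f_i(x − zα_i) dx if α_i is irrational. Then for every z ∈ ℤ, lim_{i→∞} Ξ_i(z) = ∫₀¹ f(x)·f(x − zα) dx. -/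

import Mathlib

open MeasureTheory Filter

/-- A function that is continuous at almost every point is a.e. strongly measurable. -/
lemma aestronglyMeasurable_of_ae_continuousAt {f : ℝ → ℝ}
    (hf : volume {x : ℝ | ¬ ContinuousAt f x} = 0) : AEStronglyMeasurable f volume := by
  have hm : MeasurableSet {x : ℝ | ContinuousAt f x} := measurableSet_of_continuousAt f
  have hc : ContinuousOn f {x : ℝ | ContinuousAt f x} :=
    fun x hx => ContinuousAt.continuousWithinAt hx
  have h := hc.aestronglyMeasurable (μ := volume) hm
  have hmem : ∀ᵐ x ∂(volume : Measure ℝ), x ∈ {x : ℝ | ContinuousAt f x} := hf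
  rwa [Measure.restrict_eq_self_of_ae_mem hmem] at h

/-- The integral over `[0, 1]` of a step function with steps of length `1 / q`. -/
lemma integral_floor_mul (G : ℤ → ℝ) {q : ℕ} (hq : 0 < q) :
    ∫ x in (0 : ℝ)..1, G ⌊(q : ℝ) * x⌋ = (1 / (q : ℝ)) * ∑ j ∈ Finset.range q, G j := by
  have hq' : (q : ℝ) ≠ 0 := by positivity
  have hpiece : ∀ k : ℕ, Set.EqOn (fun x : ℝ => G ⌊x⌋) (fun _ => G k)
      (Set.Ioo (k : ℝ) ((k + 1 : ℕ) : ℝ)) := by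
    intro k x hx
    have : ⌊x⌋ = (k : ℤ) := by
      rw [Int.floor_eq_iff]
      push_cast at hx ⊢
      exact ⟨hx.1.le, hx.2⟩
    simp [this]
  have hae : ∀ k : ℕ, ∀ᵐ x ∂(volume : Measure ℝ),
      x ∈ Set.uIoc (k : ℝ) ((k + 1 : ℕ) : ℝ) → G ⌊x⌋ = G k := by
    intro k
    filter_upwards [Measure.ae_ne volume ((k + 1 : ℕ) : ℝ)] with x hne hx
    rw [Set.uIoc_of_le (by push_cast; linarith)] at hx
    exact hpiece k ⟨hx.1, lt_of_le_of_ne hx.2 hne⟩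
  have hint : ∀ k < q, IntervalIntegrable (fun x : ℝ => G ⌊x⌋) volume (k : ℝ)
      ((k + 1 : ℕ) : ℝ) := by
    intro k _
    refine (intervalIntegrable_const (c := G k)).congr_ae ?_
    rw [Filter.EventuallyEq, ae_restrict_iff' measurableSet_uIoc]
    filter_upwards [hae k] with x hx hmem using (hx hmem).symm
  have hsum := intervalIntegral.sum_integral_adjacent_intervals hint
  have hscale := intervalIntegral.integral_comp_mul_left (a := 0) (b := 1)
    (fun x : ℝ => G ⌊x⌋) hq'
  rw [hscale, mul_zero, mul_one, smul_eq_mul, one_div]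
  rw [Nat.cast_zero] at hsum
  rw [← hsum]
  congr 1
  refine Finset.sum_congr rfl fun k _ => ?_
  rw [intervalIntegral.integral_congr_ae (hae k)]
  simp

/-- Affine reindexing of the sum of a `q`-periodic function over a full period. -/
lemma sum_range_periodic_affine (H : ℤ → ℝ) {q : ℕ} (hq : 0 < q) (hH : Function.Periodic H q)
    {p : ℕ} (hp : p.Coprime q) (n : ℤ) :
    ∑ k ∈ Finset.range q, H (k * p + n) = ∑ k ∈ Finset.range q, H k := by
  have : NeZero q := ⟨hq.ne'⟩
  set h : ZMod q → ℝ := fun c => H c.val with hh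
  have hfac : ∀ m : ℤ, H m = h m := by
    intro m
    simp only [hh]
    rw [ZMod.val_intCast]
    have h1 := hH.int_mul (m / q) (m % q)
    rw [← h1]
    congr 1
    have := Int.emod_add_mul_ediv m q
    rw [Int.cast_id]
    linarith
  have hrange : ∀ g : ZMod q → ℝ, ∑ k ∈ Finset.range q, g k = ∑ c, g c := by
    intro g
    refine Finset.sum_nbij' (fun k : ℕ => (k : ZMod q)) ZMod.val ?_ ?_ ?_ ?_ ?_
    · simp
    · intro c _
      exact Finset.mem_range.mpr (ZMod.val_lt c)
    · intro k hk
      exact ZMod.val_cast_of_lt (Finset.mem_range.mp hk)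
    · intro c _
      exact ZMod.natCast_zmod_val c
    · intro k _
      rfl
  have hL := hrange fun c => h (c * p + n)
  have hR := hrange h
  have hunit := ZMod.coe_unitOfCoprime p hp
  have hperm : ∑ c, h (c * p + n) = ∑ c, h c := by
    rw [← hunit]
    exact Equiv.sum_comp ((Units.mulRight (ZMod.unitOfCoprime p hp)).trans
      (Equiv.addRight (n : ZMod q))) h
  calc ∑ k ∈ Finset.range q, H (k * p + n)
      = ∑ k ∈ Finset.range q, h (k * p + n) :=
        Finset.sum_congr rfl fun k _ => by rw [hfac]; push_cast; rfl
    _ = ∑ k ∈ Finset.range q, h k := by rw [hL, hR, hperm]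
    _ = ∑ k ∈ Finset.range q, H k :=
        Finset.sum_congr rfl fun k _ => by rw [hfac]; push_cast; rfl

/-- The orbit average of a `1`-periodic function under the rational rotation by `p / q`, as an
integral along a step function that differs from the identity by at most `1 / q`. -/
lemma orbit_average_eq_integral {F : ℝ → ℝ} (hF : Function.Periodic F 1) {p q : ℕ}
    (hq : 0 < q) (hpq : p.Coprime q) (y : ℝ) :
    ∃ s : ℝ → ℝ, Measurable (fun x => F (s x)) ∧ (∀ x, |s x - x| ≤ 1 / q) ∧
      (1 / (q : ℝ)) * ∑ k ∈ Finset.range q, F (y + k * ((p : ℝ) / q)) =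
        ∫ x in (0 : ℝ)..1, F (s x) := by
  have hq' : (0 : ℝ) < q := by positivity
  set t : ℝ := Int.fract (q * y) / q with ht
  have ht0 : 0 ≤ t := by positivity
  have ht1 : t ≤ 1 / q := by
    rw [ht]
    gcongr
    exact (Int.fract_lt_one _).le
  set H : ℤ → ℝ := fun m => F (t + m / q) with hHdef
  have hH : Function.Periodic H q := by
    intro m
    simp only [hHdef]
    rw [← hF (t + m / q)]
    congr 1
    push_cast
    field_simp
    ring
  refine ⟨fun x => t + (⌊(q : ℝ) * x⌋ : ℝ) / q, ?_, ?_, ?_⟩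
  · exact (measurable_from_top (f := H)).comp
      (Int.measurable_floor.comp (measurable_const_mul (q : ℝ)))
  · intro x
    have h1 : (⌊(q : ℝ) * x⌋ : ℝ) / q ≤ x := by
      rw [div_le_iff₀ hq', mul_comm x]
      exact Int.floor_le _
    have h2 : x - 1 / q ≤ (⌊(q : ℝ) * x⌋ : ℝ) / q := by
      rw [le_div_iff₀ hq', sub_mul, one_div, inv_mul_cancel₀ hq'.ne', mul_comm x]
      exact (Int.sub_one_lt_floor _).le
    rw [abs_le]
    constructor <;> linarith
  · rw [integral_floor_mul H hq, ← sum_range_periodic_affine H hq hH hpq ⌊(q : ℝ) * y⌋]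
    congr 1
    refine Finset.sum_congr rfl fun k _ => ?_
    simp only [hHdef]
    congr 1
    have := Int.fract_add_floor ((q : ℝ) * y)
    have hy : y = (Int.fract ((q : ℝ) * y) + ⌊(q : ℝ) * y⌋) / q := by
      rw [this, mul_div_cancel_left₀ _ hq'.ne']
    rw [ht]
    push_cast
    nth_rewrite 1 [hy]
    ring

/-- If `a i → α` with `a i ≠ α`, then the denominators of the rational `a i` tend to infinity. -/
lemma eventually_le_den {α : ℝ} {a : ℕ → ℝ} (hne : ∀ i, a i ≠ α)
    (hlim : Tendsto a atTop (nhds α)) (N : ℕ) :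
    ∀ᶠ i in atTop, ∀ r : ℚ, a i = r → N ≤ r.den := by
  have hden : ∀ q : ℕ, ∀ᶠ i in atTop, ∀ r : ℚ, a i = r → r.den ≠ q := by
    intro q
    have hclosed : IsClosed ((fun n : ℤ => (n : ℝ)) '' {n : ℤ | (n : ℝ) ≠ α * q}) :=
      Int.isClosedEmbedding_coe_real.isClosedMap _ (isClosed_discrete _)
    have hmem : ((fun n : ℤ => (n : ℝ)) '' {n : ℤ | (n : ℝ) ≠ α * q})ᶜ ∈ nhds (α * q) := by
      refine hclosed.isOpen_compl.mem_nhds ?_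
      rintro ⟨n, hn, h⟩
      exact hn h
    filter_upwards [(hlim.mul_const (q : ℝ)).eventually hmem] with i hi r hr hrq
    have hq : (q : ℝ) ≠ 0 := by
      rw [← hrq]
      exact_mod_cast r.den_ne_zero
    have hnum : (r.num : ℝ) = a i * q := by
      rw [hr, ← hrq]
      exact_mod_cast (Rat.mul_den_eq_num r).symm
    exact hi ⟨r.num, fun h => hne i (mul_right_cancel₀ hq (hnum.symm.trans h)), hnum⟩
  have hall := (Finset.eventually_all (Finset.range N)).mpr fun q _ => hden q
  filter_upwards [hall] with i hi r hr
  by_contra! hlt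
  exact hi r.den (Finset.mem_range.mpr hlt) r hr rfl

/-- Main convergence theorem: for Riemann-integrable 1-periodic bounded nonnegative
observables `f_i → f` uniformly and rotation numbers `α_i → α`, `α_i ≠ α`, with any
reference points `y_i`, the autocorrelation coefficients of the `f_i`-weighted return
time measures converge: `Ξ_i(z) → ∫₀¹ f(x) f(x − zα) dx` for every `z ∈ ℤ`. -/
theorem rotation_autocorrelation_convergence_varying_observables
    (f : ℝ → ℝ) (hper : Function.Periodic f 1)
    (hbdd : ∃ C : ℝ, ∀ x, |f x| ≤ C) (hnn : ∀ x, 0 ≤ f x)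
    (hdisc : volume {x : ℝ | ¬ ContinuousAt f x} = 0)
    (fseq : ℕ → ℝ → ℝ)
    (hseqper : ∀ i, Function.Periodic (fseq i) 1)
    (hseqbdd : ∀ i, ∃ C : ℝ, ∀ x, |fseq i x| ≤ C)
    (hseqnn : ∀ i x, 0 ≤ fseq i x)
    (hseqdisc : ∀ i, volume {x : ℝ | ¬ ContinuousAt (fseq i) x} = 0)
    (hunif : TendstoUniformly fseq f atTop)
    (α : ℝ) (hαpos : 0 < α)
    (αseq : ℕ → ℝ) (hseqpos : ∀ i, 0 < αseq i)
    (hne : ∀ i, αseq i ≠ α) (hlim : Tendsto αseq atTop (nhds α))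
    (y : ℕ → ℝ)
    (Ξ : ℕ → ℤ → ℝ)
    (hΞrat : ∀ i (p q : ℕ), 0 < p → 0 < q → Nat.Coprime p q → αseq i = (p : ℝ) / q →
      ∀ z : ℤ, Ξ i z = (1 / (q : ℝ)) *
        ∑ k ∈ Finset.range q,
          fseq i (y i + (k : ℝ) * αseq i) * fseq i (y i + ((k : ℝ) - (z : ℝ)) * αseq i))
    (hΞirr : ∀ i, Irrational (αseq i) →
      ∀ z : ℤ, Ξ i z = ∫ x in (0:ℝ)..1, fseq i x * fseq i (x - (z : ℝ) * αseq i)) :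
    ∀ z : ℤ,
      Tendsto (fun i => Ξ i z) atTop
        (nhds (∫ x in (0:ℝ)..1, f x * f (x - (z : ℝ) * α))) := by
  intro z
  set F : ℕ → ℝ → ℝ := fun i x => fseq i x * fseq i (x - z * αseq i) with hFdef
  have hFper : ∀ i, Function.Periodic (F i) 1 := by
    intro i x
    simp only [hFdef]
    rw [hseqper i x, show x + 1 - z * αseq i = x - z * αseq i + 1 by ring, hseqper i]
  have hFmeas : ∀ i, AEStronglyMeasurable (F i) volume := by
    intro i
    have h := aestronglyMeasurable_of_ae_continuousAt (hseqdisc i)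
    exact h.mul (h.comp_quasiMeasurePreserving
      (measurePreserving_sub_right volume (z * αseq i)).quasiMeasurePreserving)
  have hrepr : ∀ i, ∃ s : ℝ → ℝ, AEStronglyMeasurable (fun x => F i (s x)) volume ∧
      (∀ x, s x = x ∨ ∃ r : ℚ, αseq i = r ∧ |s x - x| ≤ 1 / r.den) ∧
      Ξ i z = ∫ x in (0 : ℝ)..1, F i (s x) := by
    intro i
    by_cases hirr : Irrational (αseq i)
    · exact ⟨id, hFmeas i, fun x => Or.inl rfl, hΞirr i hirr z⟩
    · obtain ⟨r, hr⟩ := not_not.mp hirr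
      have hrpos : 0 < r := by
        have := hseqpos i
        rw [← hr] at this
        exact_mod_cast this
      have hnum : 0 < r.num := Rat.num_pos.mpr hrpos
      have hα : αseq i = (r.num.natAbs : ℝ) / r.den := by
        rw [← hr, Nat.cast_natAbs, abs_of_pos hnum]
        exact_mod_cast (Rat.num_div_den r).symm
      obtain ⟨s, hs, hdist, hsum⟩ :=
        orbit_average_eq_integral (hFper i) r.den_pos r.reduced (y i)
      refine ⟨s, hs.aestronglyMeasurable, fun x => Or.inr ⟨r, hr.symm, hdist x⟩, ?_⟩
      rw [← hsum, hΞrat i _ _ (Int.natAbs_pos.mpr hnum.ne') r.den_pos r.reduced hα z]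
      congr 1
      refine Finset.sum_congr rfl fun k _ => ?_
      simp only [hFdef]
      rw [← hα]
      congr 2
      ring
  choose s hsmeas hsdist hΞ using hrepr
  have hs : ∀ x, Tendsto (fun i => s i x) atTop (nhds x) := by
    intro x
    rw [Metric.tendsto_nhds]
    intro ε hε
    obtain ⟨N, hN⟩ := exists_nat_gt (1 / ε)
    filter_upwards [eventually_le_den hne hlim N] with i hi
    rw [Real.dist_eq]
    rcases hsdist i x with h | ⟨r, hr, h⟩
    · simpa [h] using hε
    · refine h.trans_lt ?_
      have hle : (N : ℝ) ≤ r.den := by exact_mod_cast hi r hr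
      exact (one_div_lt hε (by exact_mod_cast r.den_pos)).mp (hN.trans_le hle)
  have hcont : ∀ᵐ x ∂(volume : Measure ℝ), ContinuousAt f x := hdisc
  have hcont' : ∀ᵐ x ∂(volume : Measure ℝ), ContinuousAt f (x - z * α) :=
    (measurePreserving_sub_right volume (z * α)).quasiMeasurePreserving.ae hcont
  obtain ⟨C, hC⟩ := hbdd
  have hbound : ∀ᶠ i in atTop, ∀ x, |fseq i x| ≤ C + 1 := by
    filter_upwards [Metric.tendstoUniformly_iff.mp hunif 1 one_pos] with i hi x
    have h1 := hi x
    rw [Real.dist_eq, abs_sub_comm] at h1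
    have h2 := abs_sub_abs_le_abs_sub (fseq i x) (f x)
    linarith [hC x]
  simp only [hΞ]
  refine intervalIntegral.tendsto_integral_filter_of_dominated_convergence
    (fun _ => (C + 1) * (C + 1)) ?_ ?_ intervalIntegrable_const ?_
  · exact Eventually.of_forall fun i => (hsmeas i).restrict
  · filter_upwards [hbound] with i hi
    refine Eventually.of_forall fun x _ => ?_
    simp only [hFdef, Real.norm_eq_abs, abs_mul]
    exact mul_le_mul (hi _) (hi _) (abs_nonneg _) ((abs_nonneg _).trans (hi 0))
  · filter_upwards [hcont, hcont'] with x hx hx' _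
    exact (hunif.tendsto_comp hx (hs x)).mul
      (hunif.tendsto_comp hx' ((hs x).sub (hlim.const_mul (z : ℝ))))
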